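/- Let F, r_k, d_{k+1} be commuting bounded operators with ‖F‖ = 1, ‖d_{k+1}‖ ≤ 1, ‖r_k‖ < 2^{k+1}, and suppose ‖d_{k+1}[F,a]‖ < 2^{−k²} and ‖[d_{k+1},a]‖ < 2^{−k²} for a bounded operator a. Then ‖ad_{F(r_k + 2^{k+1} d_{k+1})}ⁿ(a) − ad_{F r_k}ⁿ(a)‖ ≤ 2^{−k² + (k+3)n}. -/

import Mathlib

/-- The iterated commutator `ad_D^n(a)`. -/
def adIter {R : Type*} [Ring R] (D : R) : ℕ → R → R
  | 0, a => a
  | n + 1, a => D * adIter D n a - adIter D n a * D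

theorem adIter_comm_step {R : Type*} [Ring R] (P Q a : R) (h : Commute P Q) (n : ℕ) :
    Q * adIter P n a - adIter P n a * Q = adIter P n (Q * a - a * Q) := by
  induction n with
  | zero => rfl
  | succ n ih =>
    simp only [adIter]
    rw [← ih]
    have h' : P * Q = Q * P := h
    simp only [mul_sub, sub_mul, mul_assoc]
    rw [h']
    simp only [← mul_assoc]
    rw [h']
    abel

theorem norm_comm_le {R : Type*} [NormedRing R] (P x : R) (M : ℝ) (hP : 2 * ‖P‖ ≤ M) :
    ‖P * x - x * P‖ ≤ M * ‖x‖ := by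
  have h1 := norm_sub_le (P * x) (x * P)
  have h2 := norm_mul_le P x
  have h3 := norm_mul_le x P
  have h4 := mul_le_mul_of_nonneg_right hP (norm_nonneg x)
  nlinarith

theorem norm_adIter_le {R : Type*} [NormedRing R] (P x : R) (M : ℝ) (hM : 0 ≤ M)
    (hP : 2 * ‖P‖ ≤ M) (n : ℕ) : ‖adIter P n x‖ ≤ M ^ n * ‖x‖ := by
  induction n with
  | zero => simp [adIter]
  | succ n ih =>
    simp only [adIter]
    refine (norm_comm_le P _ M hP).trans ?_
    rw [pow_succ', mul_assoc]
    exact mul_le_mul_of_nonneg_left ih hM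

theorem adIter_add_sub {R : Type*} [NormedRing R] (P Q a : R) (h : Commute P Q) (M e : ℝ)
    (hM : 0 ≤ M) (hP : 2 * ‖P‖ ≤ M) (hQ : 2 * ‖Q‖ ≤ M) (he : ‖Q * a - a * Q‖ ≤ M * e) (n : ℕ) :
    ‖adIter (P + Q) n a - adIter P n a‖ ≤ (2 ^ n - 1) * M ^ n * e := by
  induction n with
  | zero => simp [adIter]
  | succ n ih =>
    have key : adIter (P + Q) (n + 1) a - adIter P (n + 1) a =
        ((P + Q) * (adIter (P + Q) n a - adIter P n a)
          - (adIter (P + Q) n a - adIter P n a) * (P + Q)) + adIter P n (Q * a - a * Q) := by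
      rw [← adIter_comm_step P Q a h n]
      simp only [adIter]
      noncomm_ring
    rw [key]
    refine (norm_add_le _ _).trans ?_
    have h1 := norm_comm_le (P + Q) (adIter (P + Q) n a - adIter P n a) (2 * M)
      (by linarith [norm_add_le P Q])
    have h2 := norm_adIter_le P (Q * a - a * Q) M hM hP n
    have h3 := mul_le_mul_of_nonneg_left he (pow_nonneg hM n)
    have h4 := mul_le_mul_of_nonneg_left ih (by linarith : 0 ≤ 2 * M)
    calc _ ≤ 2 * M * ((2 ^ n - 1) * M ^ n * e) + M ^ n * (M * e) := by linarith
      _ = _ := by ring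

/-- for commuting bounded operators `F, r, d` with `‖F‖ = 1`, `‖d‖ ≤ 1`,
`‖r‖ < 2^{k+1}`, `‖d[F,a]‖ < 2^{−k²}` and `‖[d,a]‖ < 2^{−k²}`, one has
`‖ad_{F(r + 2^{k+1}d)}ⁿ(a) − ad_{Fr}ⁿ(a)‖ ≤ 2^{−k² + (k+3)n}`. -/
theorem stmt_5 {R : Type*} [NormedRing R] (F r d a : R) (k n : ℕ)
    (hFr : Commute F r) (hFd : Commute F d) (hrd : Commute r d)
    (hF : ‖F‖ = 1) (hd : ‖d‖ ≤ 1) (hr : ‖r‖ < 2 ^ (k + 1))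
    (hda1 : ‖d * (F * a - a * F)‖ < (2 : ℝ) ^ (-(k : ℤ) ^ 2))
    (hda2 : ‖d * a - a * d‖ < (2 : ℝ) ^ (-(k : ℤ) ^ 2)) :
    ‖adIter (F * (r + (2 ^ (k + 1) : ℕ) • d)) n a - adIter (F * r) n a‖ ≤
      (2 : ℝ) ^ (-(k : ℤ) ^ 2 + ((k : ℤ) + 3) * n) := by
  set e : ℝ := (2 : ℝ) ^ (-(k : ℤ) ^ 2) with he
  have he0 : 0 < e := by positivity
  set D : R := (2 ^ (k + 1) : ℕ) • d with hD
  have hFD : Commute F D := hFd.smul_right _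
  have hrD : Commute r D := hrd.smul_right _
  have hPQ : Commute (F * r) (F * D) :=
    ((Commute.refl F).mul_right hFD).mul_left ((hFr.symm).mul_right hrD)
  have hP : 2 * ‖F * r‖ ≤ 2 ^ (k + 2) := by
    have := norm_mul_le F r
    rw [hF] at this
    rw [pow_succ]; linarith
  have hDn : ∀ x : R, ‖(2 ^ (k + 1) : ℕ) • x‖ ≤ 2 ^ (k + 1) * ‖x‖ := by
    intro x
    have := norm_nsmul_le (n := 2 ^ (k + 1)) (a := x)
    push_cast at this
    exact this
  have hpos : (0 : ℝ) < 2 ^ (k + 1) := by positivity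
  have hQ : 2 * ‖F * D‖ ≤ 2 ^ (k + 2) := by
    have h1 := norm_mul_le F D
    rw [hF] at h1
    have h2 := hDn d
    rw [pow_succ]; nlinarith
  have hQa : ‖F * D * a - a * (F * D)‖ ≤ 2 ^ (k + 2) * e := by
    have h0 : F * D * a - a * (F * D) =
        (2 ^ (k + 1) : ℕ) • (d * (F * a - a * F) + (d * a - a * d) * F) := by
      have h' : F * d = d * F := hFd
      rw [hD, mul_smul_comm, smul_mul_assoc, mul_smul_comm, ← smul_sub, h']
      congr 1
      noncomm_ring
    rw [h0]
    refine (hDn _).trans ?_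
    have h1 := norm_add_le (d * (F * a - a * F)) ((d * a - a * d) * F)
    have h2 := norm_mul_le (d * a - a * d) F
    rw [hF] at h2
    have h3 : ‖d * (F * a - a * F) + (d * a - a * d) * F‖ ≤ 2 * e := by linarith
    calc _ ≤ 2 ^ (k + 1) * (2 * e) := mul_le_mul_of_nonneg_left h3 hpos.le
      _ = _ := by ring
  have hfin := adIter_add_sub (F * r) (F * D) a hPQ (2 ^ (k + 2)) e (by positivity) hP hQ hQa n
  rw [mul_add]
  refine hfin.trans ?_
  have hz : (2 : ℝ) ^ (-(k : ℤ) ^ 2 + ((k : ℤ) + 3) * n) = 2 ^ n * (2 ^ (k + 2)) ^ n * e := by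
    rw [zpow_add₀ (by norm_num), ← he, zpow_mul, zpow_natCast, ← mul_pow, mul_comm]
    congr 2
    rw [← pow_succ']
    exact_mod_cast zpow_natCast (2 : ℝ) (k + 3)
  rw [hz]
  have : (0 : ℝ) ≤ (2 ^ (k + 2)) ^ n * e := by positivity
  linarith
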